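/- arXiv:1912.00002 — 9 statements merged into one kernel-verified Lean document; each statement's English description precedes it below -/
import Mathlib

section
/- There do not exist real polynomials P and Q such that Q(x) ≠ 0 for all x ≥ 0 and the two-sided bound ln(1+x) ≤ P(x)/Q(x) ≤ f(x)/√(x+1) holds for all real x ≥ 0. -/
open Real Set

noncomputable def f (x : ℝ) : ℝ :=
  π + (1 / 2) * (4 + π) * x - 2 * (x + 2) * Real.arctan (Real.sqrt (x + 1))

theorem f_le_two_mul {x : ℝ} (hx : 0 ≤ x) : f x ≤ 2 * x := by
  have h1 : (1 : ℝ) ≤ Real.sqrt (x + 1) := Real.one_le_sqrt.mpr (by linarith)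
  have h2 : π / 4 ≤ Real.arctan (Real.sqrt (x + 1)) := by
    rw [← Real.arctan_one]
    exact Real.arctan_strictMono.monotone h1
  have h3 := mul_le_mul_of_nonneg_left h2 (by linarith : 0 ≤ 2 * (x + 2))
  unfold f
  linarith

theorem f_div_sqrt_le {x : ℝ} (hx : 0 ≤ x) : f x / Real.sqrt (x + 1) ≤ 2 * Real.sqrt (x + 1) := by
  rw [div_le_iff₀ (Real.sqrt_pos.mpr (by linarith)), mul_assoc, Real.mul_self_sqrt (by linarith)]
  linarith [f_le_two_mul hx]

theorem no_rational_intermediate_above :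
    ¬ ∃ P Q : Polynomial ℝ,
      (∀ x : ℝ, 0 ≤ x → Q.eval x ≠ 0) ∧
      (∀ x : ℝ, 0 ≤ x →
        Real.log (1 + x) ≤ P.eval x / Q.eval x ∧
        P.eval x / Q.eval x ≤ f x / Real.sqrt (x + 1)) := by
  rintro ⟨P, Q, hQ, hPQ⟩
  have hQ0 : Q ≠ 0 := by
    rintro rfl
    exact hQ 0 le_rfl (by simp)
  rcases le_or_gt P.degree Q.degree with hdeg | hdeg
  · obtain ⟨C, hC⟩ := (Polynomial.isBigO_atTop_of_degree_le P Q hdeg).bound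
    obtain ⟨x, hx, hx0, hxC⟩ := (hC.and ((Filter.eventually_ge_atTop 0).and
      (Filter.eventually_ge_atTop (Real.exp (C + 1))))).exists
    have hlog : C + 1 ≤ Real.log (1 + x) :=
      (Real.le_log_iff_exp_le (by linarith)).mpr (by linarith)
    have hle : P.eval x / Q.eval x ≤ C := by
      refine (le_abs_self _).trans ?_
      rw [abs_div, div_le_iff₀ (abs_pos.mpr (hQ x hx0))]
      exact hx
    linarith [(hPQ x hx0).1]
  · have hdeg' : (Polynomial.X * Q).degree ≤ P.degree := by
      rw [mul_comm, Polynomial.degree_mul_X, Polynomial.degree_eq_natDegree hQ0] at *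
      have hP0 : P ≠ 0 := by
        rintro rfl
        simp at hdeg
      rw [Polynomial.degree_eq_natDegree hP0] at *
      exact_mod_cast hdeg
    obtain ⟨C, hC0, hC⟩ := (Polynomial.isBigO_atTop_of_degree_le _ P hdeg').exists_pos
    obtain ⟨x, hx, hx1, hxC⟩ := (hC.bound.and ((Filter.eventually_ge_atTop 1).and
      (Filter.eventually_ge_atTop (8 * C ^ 2 + 1)))).exists
    have hx0 : 0 ≤ x := by linarith
    have hnonneg : 0 ≤ P.eval x / Q.eval x :=
      (Real.log_nonneg (by linarith)).trans (hPQ x hx0).1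
    have hupper := (hPQ x hx0).2.trans (f_div_sqrt_le hx0)
    have hlower : x ≤ C * (P.eval x / Q.eval x) := by
      rw [← abs_of_nonneg hnonneg, abs_div, ← mul_div_assoc,
        le_div_iff₀ (abs_pos.mpr (hQ x hx0))]
      simpa [abs_mul, abs_of_nonneg hx0] using hx
    have hx2 : x ≤ C * (2 * Real.sqrt (x + 1)) :=
      hlower.trans (mul_le_mul_of_nonneg_left hupper hC0.le)
    have hsq : x ^ 2 ≤ 4 * C ^ 2 * (x + 1) := by
      calc x ^ 2 ≤ (C * (2 * Real.sqrt (x + 1))) ^ 2 := pow_le_pow_left₀ hx0 hx2 2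
        _ = 4 * C ^ 2 * Real.sqrt (x + 1) ^ 2 := by ring
        _ = 4 * C ^ 2 * (x + 1) := by rw [Real.sq_sqrt (by linarith)]
    nlinarith [sq_nonneg C]
end

section
/- Let a ∈ (0,1), let P : (1−a, 1+a) → ℝ satisfy P(1) = 0 and P′(1) ≥ 2, and suppose there exists an odd natural number n such that P is (n+2)-times differentiable on (1−a,1+a), P^(n+2)(1) + 2·(−1)^(n+1)·n! > 0, and P^(j)(1) + 2·(−1)^(j+1)·(j−2)! = 0 for every j = 2, 3, …, n+1. Then there exists a real number ζ ∈ (0, a] such that 2t·ln t ≤ P(t) for all t ∈ [1, 1+ζ] and 2t·ln t ≥ P(t) for all t ∈ [1−ζ, 1]. -/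
open Real Set

/-- `f` is nonpositive just to the left of `1` and nonnegative just to the right of it. -/
def SignChangeAtOne (a : ℝ) (f : ℝ → ℝ) : Prop :=
  ∃ ζ ∈ Ioc (0 : ℝ) a, (∀ t ∈ Icc (1 : ℝ) (1 + ζ), 0 ≤ f t) ∧ ∀ t ∈ Icc (1 - ζ) (1 : ℝ), f t ≤ 0

/-- `f` is nonnegative near `1`. -/
def NonnegNearOne (a : ℝ) (f : ℝ → ℝ) : Prop :=
  ∃ ζ ∈ Ioc (0 : ℝ) a, ∀ t ∈ Icc (1 - ζ) (1 + ζ), 0 ≤ f t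

theorem NonnegNearOne.signChangeAtOne {a : ℝ} {f g : ℝ → ℝ} (hg : NonnegNearOne a g)
    (hd : ∀ t ∈ Ioo (1 - a) (1 + a), HasDerivAt f (g t) t) (h1 : f 1 = 0) :
    SignChangeAtOne a f := by
  obtain ⟨ζ, ⟨hζ, hζa⟩, h⟩ := hg
  have hmem : ∀ t ∈ Icc (1 - ζ / 2) (1 + ζ / 2), t ∈ Ioo (1 - a) (1 + a) := fun t ht =>
    ⟨by linarith [ht.1], by linarith [ht.2]⟩
  have hm : MonotoneOn f (Icc (1 - ζ / 2) (1 + ζ / 2)) := by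
    refine monotoneOn_of_hasDerivWithinAt_nonneg (f' := g) (convex_Icc _ _)
      (fun t ht => (hd t (hmem t ht)).continuousAt.continuousWithinAt)
      (fun t ht => (hd t (hmem t (interior_subset ht))).hasDerivWithinAt) (fun t ht => ?_)
    have := interior_subset ht
    exact h t ⟨by linarith [this.1], by linarith [this.2]⟩
  refine ⟨ζ / 2, ⟨by linarith, by linarith⟩, fun t ht => ?_, fun t ht => ?_⟩
  · rw [← h1]
    exact hm ⟨by linarith, by linarith⟩ ⟨by linarith [ht.1], ht.2⟩ ht.1
  · rw [← h1]
    exact hm ⟨ht.1, by linarith [ht.2]⟩ ⟨by linarith, by linarith⟩ ht.2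

theorem SignChangeAtOne.nonnegNearOne {a : ℝ} {f g : ℝ → ℝ} (hg : SignChangeAtOne a g)
    (hd : ∀ t ∈ Ioo (1 - a) (1 + a), HasDerivAt f (g t) t) (h1 : 0 ≤ f 1) :
    NonnegNearOne a f := by
  obtain ⟨ζ, ⟨hζ, hζa⟩, hr, hl⟩ := hg
  have hmem : ∀ t ∈ Icc (1 - ζ / 2) (1 + ζ / 2), t ∈ Ioo (1 - a) (1 + a) := fun t ht =>
    ⟨by linarith [ht.1], by linarith [ht.2]⟩
  have hmr : MonotoneOn f (Icc 1 (1 + ζ / 2)) := by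
    have hs : Icc 1 (1 + ζ / 2) ⊆ Icc (1 - ζ / 2) (1 + ζ / 2) :=
      Icc_subset_Icc_left (by linarith)
    refine monotoneOn_of_hasDerivWithinAt_nonneg (f' := g) (convex_Icc _ _)
      (fun t ht => (hd t (hmem t (hs ht))).continuousAt.continuousWithinAt)
      (fun t ht => (hd t (hmem t (hs (interior_subset ht)))).hasDerivWithinAt) (fun t ht => ?_)
    have := interior_subset ht
    exact hr t ⟨this.1, by linarith [this.2]⟩
  have hml : AntitoneOn f (Icc (1 - ζ / 2) 1) := by
    have hs : Icc (1 - ζ / 2) 1 ⊆ Icc (1 - ζ / 2) (1 + ζ / 2) :=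
      Icc_subset_Icc_right (by linarith)
    refine antitoneOn_of_hasDerivWithinAt_nonpos (f' := g) (convex_Icc _ _)
      (fun t ht => (hd t (hmem t (hs ht))).continuousAt.continuousWithinAt)
      (fun t ht => (hd t (hmem t (hs (interior_subset ht)))).hasDerivWithinAt) (fun t ht => ?_)
    have := interior_subset ht
    exact hl t ⟨by linarith [this.1], this.2⟩
  refine ⟨ζ / 2, ⟨by linarith, by linarith⟩, fun t ht => h1.trans ?_⟩
  rcases le_total 1 t with h | h
  · exact hmr ⟨le_rfl, by linarith⟩ ⟨h, ht.2⟩ h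
  · exact hml ⟨ht.1, h⟩ ⟨by linarith, le_rfl⟩ h

/-- A function vanishing at `1` with positive derivative there changes sign at `1`. -/
theorem signChangeAtOne_of_hasDerivAt_pos {a : ℝ} (ha : 0 < a) {f : ℝ → ℝ} {c : ℝ}
    (hd : HasDerivAt f c 1) (hc : 0 < c) (h1 : f 1 = 0) : SignChangeAtOne a f := by
  have h := hasDerivAt_iff_tendsto_slope.1 hd |>.eventually (eventually_gt_nhds hc)
  rw [eventually_nhdsWithin_iff, Metric.eventually_nhds_iff] at h
  obtain ⟨ε, hε, h⟩ := h
  have hpos : 0 < min (ε / 2) a := lt_min (by linarith) ha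
  have hle : min (ε / 2) a ≤ ε / 2 := min_le_left _ _
  have key : ∀ t, |t - 1| < ε → t ≠ 1 → 0 < (t - 1)⁻¹ * f t := fun t ht hne => by
    simpa [slope, h1] using h (by rwa [Real.dist_eq]) hne
  refine ⟨min (ε / 2) a, ⟨hpos, min_le_right _ _⟩, fun t ht => ?_, fun t ht => ?_⟩
  · rcases ht.1.eq_or_lt with rfl | hlt
    · exact h1.ge
    · have := key t (abs_lt.2 ⟨by linarith, by linarith [ht.2]⟩) hlt.ne'
      exact (pos_of_mul_pos_right this (inv_nonneg.2 (by linarith))).le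
  · rcases ht.2.eq_or_lt with rfl | hlt
    · exact h1.le
    · have := key t (abs_lt.2 ⟨by linarith [ht.1], by linarith⟩) hlt.ne
      by_contra! hf
      exact absurd this (mul_nonpos_of_nonpos_of_nonneg
        (inv_nonpos.2 (by linarith)) hf.le).not_gt

/-- Sign changes propagate from the derivative of order `2 * m` down to the function. -/
theorem signChangeAtOne_of_iterated {a : ℝ} (G : ℕ → ℝ → ℝ) (m : ℕ)
    (hd : ∀ j < 2 * m, ∀ t ∈ Ioo (1 - a) (1 + a), HasDerivAt (G j) (G (j + 1) t) t)
    (heven : ∀ j < m, G (2 * j) 1 = 0) (hodd : ∀ j < m, 0 ≤ G (2 * j + 1) 1)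
    (h : SignChangeAtOne a (G (2 * m))) : SignChangeAtOne a (G 0) := by
  induction m with
  | zero => exact h
  | succ m ih =>
    refine ih (fun j hj => hd j (by omega)) (fun j hj => heven j (by omega))
      (fun j hj => hodd j (by omega)) ?_
    exact (h.nonnegNearOne (hd (2 * m + 1) (by omega)) (hodd m (by omega))).signChangeAtOne
      (hd (2 * m) (by omega)) (heven m (by omega))

/-- The successive derivatives of `t ↦ 2 * t * log t` on the positive reals. -/
noncomputable def twoMulLogDeriv : ℕ → ℝ → ℝ
  | 0, t => 2 * t * log t
  | 1, t => 2 * log t + 2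
  | j + 2, t => 2 * (-1) ^ j * (j.factorial : ℝ) * (t ^ (j + 1))⁻¹

theorem hasDerivAt_twoMulLogDeriv (j : ℕ) {t : ℝ} (ht : 0 < t) :
    HasDerivAt (twoMulLogDeriv j) (twoMulLogDeriv (j + 1) t) t := by
  match j with
  | 0 =>
    have h := ((hasDerivAt_id t).const_mul 2).mul (Real.hasDerivAt_log ht.ne')
    refine h.congr_deriv ?_
    simp only [twoMulLogDeriv, id]
    field_simp
  | 1 =>
    have h := ((Real.hasDerivAt_log ht.ne').const_mul 2).add_const 2
    refine h.congr_deriv ?_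
    simp [twoMulLogDeriv]
  | j + 2 =>
    have h := ((hasDerivAt_pow (j + 1) t).inv (pow_ne_zero _ ht.ne')).const_mul
      (2 * (-1) ^ j * (j.factorial : ℝ))
    refine h.congr_deriv ?_
    simp only [twoMulLogDeriv, Nat.factorial_succ, Nat.add_sub_cancel]
    push_cast
    field_simp
    ring

theorem local_bounds_odd_case (a : ℝ) (ha : a ∈ Set.Ioo (0 : ℝ) 1) (P : ℝ → ℝ)
    (hP0 : P 1 = 0) (hP1 : deriv P 1 ≥ 2) (n : ℕ) (hodd : Odd n)
    (hdiff : ∀ j < n + 2, DifferentiableOn ℝ (iteratedDeriv j P) (Set.Ioo (1 - a) (1 + a)))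
    (htop : iteratedDeriv (n + 2) P 1 + 2 * (-1 : ℝ) ^ (n + 1) * (Nat.factorial n : ℝ) > 0)
    (hmid : ∀ j : ℕ, 2 ≤ j → j ≤ n + 1 →
      iteratedDeriv j P 1 + 2 * (-1 : ℝ) ^ (j + 1) * (Nat.factorial (j - 2) : ℝ) = 0) :
    ∃ ζ ∈ Set.Ioc (0 : ℝ) a,
      (∀ t ∈ Set.Icc (1 : ℝ) (1 + ζ), 2 * t * Real.log t ≤ P t) ∧
      (∀ t ∈ Set.Icc (1 - ζ) (1 : ℝ), 2 * t * Real.log t ≥ P t) := by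
  obtain ⟨ha0, ha1⟩ := ha
  have h1mem : (1 : ℝ) ∈ Ioo (1 - a) (1 + a) := ⟨by linarith, by linarith⟩
  set G : ℕ → ℝ → ℝ := fun j t => iteratedDeriv j P t - twoMulLogDeriv j t with hG
  have hd : ∀ j < n + 2, ∀ t ∈ Ioo (1 - a) (1 + a), HasDerivAt (G j) (G (j + 1) t) t := by
    intro j hj t ht
    have hP := ((hdiff j hj).differentiableAt (isOpen_Ioo.mem_nhds ht)).hasDerivAt
    rw [← iteratedDeriv_succ] at hP
    exact hP.sub (hasDerivAt_twoMulLogDeriv j (by linarith [ht.1]))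
  have hG0 : G 0 1 = 0 := by simp [hG, twoMulLogDeriv, hP0]
  have hG1 : 0 ≤ G 1 1 := by
    simp only [hG, twoMulLogDeriv, iteratedDeriv_one, Real.log_one]
    linarith
  have hGmid : ∀ j, 2 ≤ j → j ≤ n + 1 → G j 1 = 0 := by
    intro j h2 hj
    obtain ⟨k, rfl⟩ := Nat.exists_eq_add_of_le' h2
    have := hmid (k + 2) h2 hj
    simp only [hG, twoMulLogDeriv, Nat.add_sub_cancel, one_pow, inv_one, mul_one] at this ⊢
    rw [← this]
    ring
  have hGtop : 0 < G (n + 2) 1 := by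
    simp only [hG, twoMulLogDeriv, one_pow, inv_one, mul_one]
    rw [pow_succ] at htop
    linarith
  obtain ⟨m, rfl⟩ := hodd
  have hsign : SignChangeAtOne a (G (2 * (m + 1))) :=
    signChangeAtOne_of_hasDerivAt_pos ha0 (hd (2 * (m + 1)) (by omega) 1 h1mem) hGtop
      (hGmid _ (by omega) (by omega))
  obtain ⟨ζ, hζ, hr, hl⟩ := signChangeAtOne_of_iterated G (m + 1)
    (fun j hj => hd j (by omega))
    (fun j hj => by
      rcases Nat.eq_zero_or_pos j with rfl | h
      · exact hG0
      · exact hGmid _ (by omega) (by omega))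
    (fun j hj => by
      rcases Nat.eq_zero_or_pos j with rfl | h
      · exact hG1
      · exact (hGmid _ (by omega) (by omega)).ge)
    hsign
  simp only [hG, twoMulLogDeriv, iteratedDeriv_zero] at hr hl
  exact ⟨ζ, hζ, fun t ht => sub_nonneg.1 (hr t ht), fun t ht => sub_nonpos.1 (hl t ht)⟩
end

section
/- Let a ∈ (0,1), let P : (1−a, 1+a) → ℝ satisfy P(1) = 0, and suppose there exists an even natural number n ≥ 6 such that P is (n+1)-times differentiable on (1−a,1+a), P^(n+1)(1) + 2·(−1)^n·(n−1)! > 0, P′(1) = 2, and P^(j)(1) + 2·(−1)^(j+1)·(j−2)! = 0 for every j = 2, 3, …, n. Then there exists a real number η ∈ (0, a] such that 2t·ln t ≤ P(t) ≤ f(t²−1) for all t ∈ [1, 1+η] and 2t·ln t ≥ P(t) ≥ f(t²−1) for all t ∈ [1−η, 1]. -/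
open Real Set

open Filter Topology

/-- Mean value theorem near a zero `c` of `u`: the intermediate point `ξ` can be taken in any
prescribed neighbourhood of `c`, on the same side of `c` as `x`. -/
theorem eventually_exists_eq_deriv_mul_sub {u v : ℝ → ℝ} {c : ℝ} {p : ℝ → Prop}
    (hu : ∀ᶠ x in 𝓝 c, HasDerivAt u (v x) x) (hc : u c = 0) (hp : ∀ᶠ x in 𝓝 c, p x) :
    ∀ᶠ x in 𝓝 c, ∃ ξ, p ξ ∧ u x = v ξ * (x - c) ∧ ∃ s, 0 ≤ s ∧ x - c = s * (ξ - c) := by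
  obtain ⟨ε, hε, h⟩ := Metric.eventually_nhds_iff_ball.1 (hu.and hp)
  rw [Real.ball_eq_Ioo] at h
  filter_upwards [Ioo_mem_nhds (sub_lt_self c hε) (lt_add_of_pos_right c hε)] with x hx
  have hmem : c ∈ Ioo (c - ε) (c + ε) := ⟨by linarith, by linarith⟩
  rcases lt_trichotomy x c with hxc | rfl | hxc
  · have hI : ∀ y ∈ Icc x c, y ∈ Ioo (c - ε) (c + ε) := fun y hy =>
      ⟨hx.1.trans_le hy.1, hy.2.trans_lt hmem.2⟩
    obtain ⟨ξ, hξ, he⟩ := exists_hasDerivAt_eq_slope u v hxc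
      (fun y hy => (h y (hI y hy)).1.continuousAt.continuousWithinAt)
      (fun y hy => (h y (hI y (Ioo_subset_Icc_self hy))).1)
    have h1 : c - x ≠ 0 := by linarith
    have h2 : ξ - c < 0 := by linarith [hξ.2]
    refine ⟨ξ, (h ξ (hI ξ (Ioo_subset_Icc_self hξ))).2, ?_, (x - c) / (ξ - c), ?_, ?_⟩
    · rw [he, hc]; field_simp; ring
    · exact div_nonneg_of_nonpos (by linarith) h2.le
    · rw [div_mul_cancel₀ _ h2.ne]
  · exact ⟨x, (h x hmem).2, by simp [hc], 0, le_rfl, by simp⟩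
  · have hI : ∀ y ∈ Icc c x, y ∈ Ioo (c - ε) (c + ε) := fun y hy =>
      ⟨hmem.1.trans_le hy.1, hy.2.trans_lt hx.2⟩
    obtain ⟨ξ, hξ, he⟩ := exists_hasDerivAt_eq_slope u v hxc
      (fun y hy => (h y (hI y hy)).1.continuousAt.continuousWithinAt)
      (fun y hy => (h y (hI y (Ioo_subset_Icc_self hy))).1)
    have h1 : x - c ≠ 0 := by linarith
    have h2 : 0 < ξ - c := by linarith [hξ.1]
    refine ⟨ξ, (h ξ (hI ξ (Ioo_subset_Icc_self hξ))).2, ?_, (x - c) / (ξ - c), ?_, ?_⟩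
    · rw [he, hc]; field_simp; ring
    · exact div_nonneg (by linarith) h2.le
    · rw [div_mul_cancel₀ _ h2.ne']

theorem eventually_nonneg_of_deriv_changes_sign {u v : ℝ → ℝ} {c : ℝ}
    (hu : ∀ᶠ x in 𝓝 c, HasDerivAt u (v x) x) (hc : u c = 0)
    (hv : ∀ᶠ x in 𝓝 c, 0 ≤ (x - c) * v x) : ∀ᶠ x in 𝓝 c, 0 ≤ u x := by
  filter_upwards [eventually_exists_eq_deriv_mul_sub hu hc hv] with x ⟨ξ, hξ, he, s, hs, hx⟩
  rw [he, hx, show v ξ * (s * (ξ - c)) = s * ((ξ - c) * v ξ) by ring]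
  exact mul_nonneg hs hξ

theorem eventually_changes_sign_of_deriv_nonneg {u v : ℝ → ℝ} {c : ℝ}
    (hu : ∀ᶠ x in 𝓝 c, HasDerivAt u (v x) x) (hc : u c = 0)
    (hv : ∀ᶠ x in 𝓝 c, 0 ≤ v x) : ∀ᶠ x in 𝓝 c, 0 ≤ (x - c) * u x := by
  filter_upwards [eventually_exists_eq_deriv_mul_sub hu hc hv] with x ⟨ξ, hξ, he, _⟩
  rw [he, show (x - c) * (v ξ * (x - c)) = v ξ * (x - c) ^ 2 by ring]
  positivity

theorem HasDerivAt.eventually_changes_sign {u : ℝ → ℝ} {c d : ℝ}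
    (hu : HasDerivAt u d c) (hd : 0 < d) (hc : u c = 0) :
    ∀ᶠ x in 𝓝 c, 0 ≤ (x - c) * u x := by
  have h := eventually_nhdsWithin_iff.1
    ((hasDerivAt_iff_tendsto_slope.1 hu).eventually (eventually_gt_nhds hd))
  filter_upwards [h] with x hx
  rcases eq_or_ne x c with rfl | hne
  · simp
  · have h1 := hx hne
    rw [slope_def_field, hc, sub_zero] at h1
    have h2 : x - c ≠ 0 := sub_ne_zero.2 hne
    rw [show (x - c) * u x = u x / (x - c) * (x - c) ^ 2 by field_simp]
    positivity

/-- If `h 0, h 1, …` are the successive derivatives of `h 0`, and the first one that does not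
vanish at `c` has odd order and is positive there, then `h 0` changes sign at `c` from `-` to `+`. -/
theorem eventually_changes_sign_of_odd_order {c d : ℝ} (hd : 0 < d) {m : ℕ} (hm : Even m)
    {h : ℕ → ℝ → ℝ} (hderiv : ∀ j < m, ∀ᶠ x in 𝓝 c, HasDerivAt (h j) (h (j + 1) x) x)
    (hzero : ∀ j ≤ m, h j c = 0) (htop : HasDerivAt (h m) d c) :
    ∀ᶠ x in 𝓝 c, 0 ≤ (x - c) * h 0 x := by
  obtain ⟨k, rfl⟩ := hm
  induction k generalizing h with
  | zero => exact htop.eventually_changes_sign hd (hzero 0 le_rfl)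
  | succ k ih =>
    have h2 := ih (h := fun j => h (j + 2)) (fun j hj => hderiv (j + 2) (by omega))
      (fun j hj => hzero (j + 2) (by omega))
      (by simpa only [show k + k + 2 = k + 1 + (k + 1) by ring] using htop)
    exact eventually_changes_sign_of_deriv_nonneg (hderiv 0 (by omega)) (hzero 0 (by omega))
      (eventually_nonneg_of_deriv_changes_sign (hderiv 1 (by omega)) (hzero 1 (by omega)) h2)

/-- The successive derivatives of `t ↦ 2 * t * log t` on the positive half-line. -/
noncomputable def mulLogDeriv : ℕ → ℝ → ℝ
  | 0, t => 2 * t * Real.log t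
  | 1, t => 2 * Real.log t + 2
  | k + 2, t => 2 * (-1) ^ k * (k.factorial : ℝ) * (t ^ (k + 1))⁻¹

theorem hasDerivAt_mulLogDeriv (j : ℕ) {t : ℝ} (ht : 0 < t) :
    HasDerivAt (mulLogDeriv j) (mulLogDeriv (j + 1) t) t := by
  match j with
  | 0 =>
    have h := ((hasDerivAt_id t).const_mul 2).mul (Real.hasDerivAt_log ht.ne')
    refine h.congr_deriv ?_
    simp only [mulLogDeriv, id]
    field_simp
  | 1 =>
    have h := ((Real.hasDerivAt_log ht.ne').const_mul 2).add_const 2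
    refine h.congr_deriv ?_
    simp [mulLogDeriv]
  | k + 2 =>
    have h := ((hasDerivAt_pow (k + 1) t).inv (pow_ne_zero _ ht.ne')).const_mul
      (2 * (-1) ^ k * (k.factorial : ℝ))
    refine h.congr_deriv ?_
    simp only [mulLogDeriv, Nat.factorial_succ, Nat.cast_mul, Nat.add_sub_cancel]
    field_simp
    ring

/-- The successive derivatives, up to order four, of `t ↦ f (t ^ 2 - 1)` on the nonnegative
half-line. -/
noncomputable def arctanBoundDeriv : ℕ → ℝ → ℝ
  | 0, t => π + (1 / 2) * (4 + π) * (t ^ 2 - 1) - 2 * (t ^ 2 + 1) * Real.arctan t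
  | 1, t => (4 + π) * t - 4 * t * Real.arctan t - 2
  | 2, t => (4 + π) - 4 * Real.arctan t - 4 * t / (1 + t ^ 2)
  | 3, t => -8 / (1 + t ^ 2) ^ 2
  | _, t => 32 * t / (1 + t ^ 2) ^ 3

theorem f_sq_sub_one {t : ℝ} (ht : 0 ≤ t) : f (t ^ 2 - 1) = arctanBoundDeriv 0 t := by
  simp only [f, arctanBoundDeriv, sub_add_cancel, Real.sqrt_sq ht]
  ring

theorem hasDerivAt_arctanBoundDeriv {j : ℕ} (hj : j < 4) (t : ℝ) :
    HasDerivAt (arctanBoundDeriv j) (arctanBoundDeriv (j + 1) t) t := by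
  have hpos : 1 + t ^ 2 ≠ 0 := by positivity
  have hid := hasDerivAt_id t
  have hsq := hasDerivAt_pow 2 t
  have hat := Real.hasDerivAt_arctan t
  have hden := hsq.const_add 1
  interval_cases j
  · refine (((hsq.sub_const 1).const_mul ((1 / 2) * (4 + π))).const_add π |>.sub
      (((hsq.add_const 1).const_mul 2).mul hat)).congr_deriv ?_
    simp only [arctanBoundDeriv]
    field_simp
    ring
  · refine (((hid.const_mul (4 + π)).sub ((hid.const_mul 4).mul hat)).sub_const 2).congr_deriv ?_
    simp only [arctanBoundDeriv, id]
    field_simp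
    ring
  · refine (((hat.const_mul 4).const_sub (4 + π)).sub
      ((hid.const_mul 4).div hden hpos)).congr_deriv ?_
    simp only [arctanBoundDeriv, id]
    field_simp
    ring
  · refine ((hasDerivAt_const t (-8 : ℝ)).div (hden.pow 2) (pow_ne_zero 2 hpos)).congr_deriv ?_
    simp only [arctanBoundDeriv, Pi.pow_apply]
    field_simp
    ring

theorem hasDerivAt_arctanBoundDeriv_four_one : HasDerivAt (arctanBoundDeriv 4) (-8) 1 := by
  refine (((hasDerivAt_id (1 : ℝ)).const_mul 32).div
    (((hasDerivAt_pow 2 (1 : ℝ)).const_add 1).pow 3) (by norm_num)).congr_deriv ?_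
  norm_num

theorem arctanBoundDeriv_one {j : ℕ} (hj : j ≤ 4) :
    arctanBoundDeriv j 1 = mulLogDeriv j 1 := by
  interval_cases j <;>
    norm_num [arctanBoundDeriv, mulLogDeriv, Real.arctan_one, Nat.factorial] <;> ring

theorem local_bounds_even_case (a : ℝ) (ha : a ∈ Set.Ioo (0 : ℝ) 1) (P : ℝ → ℝ)
    (hP0 : P 1 = 0) (n : ℕ) (heven : Even n) (hn6 : 6 ≤ n)
    (hdiff : ∀ j < n + 1, DifferentiableOn ℝ (iteratedDeriv j P) (Set.Ioo (1 - a) (1 + a)))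
    (htop : iteratedDeriv (n + 1) P 1 + 2 * (-1 : ℝ) ^ n * (Nat.factorial (n - 1) : ℝ) > 0)
    (hP1 : deriv P 1 = 2)
    (hmid : ∀ j : ℕ, 2 ≤ j → j ≤ n →
      iteratedDeriv j P 1 + 2 * (-1 : ℝ) ^ (j + 1) * (Nat.factorial (j - 2) : ℝ) = 0) :
    ∃ η ∈ Set.Ioc (0 : ℝ) a,
      (∀ t ∈ Set.Icc (1 : ℝ) (1 + η),
        2 * t * Real.log t ≤ P t ∧ P t ≤ f (t ^ 2 - 1)) ∧
      (∀ t ∈ Set.Icc (1 - η) (1 : ℝ),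
        2 * t * Real.log t ≥ P t ∧ P t ≥ f (t ^ 2 - 1)) := by
  obtain ⟨ha0, ha1⟩ := ha
  have hPderiv : ∀ j < n + 1, ∀ t ∈ Ioo (1 - a) (1 + a),
      HasDerivAt (iteratedDeriv j P) (iteratedDeriv (j + 1) P t) t := fun j hj t ht => by
    rw [iteratedDeriv_succ]
    exact ((hdiff j hj).differentiableAt (isOpen_Ioo.mem_nhds ht)).hasDerivAt
  have hmem : (1 : ℝ) ∈ Ioo (1 - a) (1 + a) := ⟨by linarith, by linarith⟩
  have hnhds : ∀ᶠ t in 𝓝 (1 : ℝ), t ∈ Ioo (1 - a) (1 + a) := isOpen_Ioo.mem_nhds hmem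
  have hPone : ∀ j ≤ n, iteratedDeriv j P 1 = mulLogDeriv j 1 := fun j hj => by
    match j with
    | 0 => simp [mulLogDeriv, hP0]
    | 1 => simp [mulLogDeriv, hP1]
    | k + 2 =>
      have h := hmid (k + 2) (by omega) hj
      simp only [Nat.add_sub_cancel] at h
      simp only [mulLogDeriv, one_pow, inv_one]
      linear_combination h
  have hlower : ∀ᶠ t in 𝓝 (1 : ℝ), 0 ≤ (t - 1) * (P t - 2 * t * Real.log t) := by
    have htop' : 0 < iteratedDeriv (n + 1) P 1 - mulLogDeriv (n + 1) 1 := by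
      obtain ⟨k, rfl⟩ : ∃ k, n = k + 1 := ⟨n - 1, by omega⟩
      simp only [Nat.add_sub_cancel, pow_succ] at htop
      simp only [mulLogDeriv, one_pow, inv_one]
      linarith
    have h := eventually_changes_sign_of_odd_order htop' heven
      (h := fun j t => iteratedDeriv j P t - mulLogDeriv j t)
      (fun j hj => hnhds.mono fun t ht => (hPderiv j (by omega) t ht).sub
        (hasDerivAt_mulLogDeriv j (by linarith [ht.1])))
      (fun j hj => sub_eq_zero.2 (hPone j hj))
      ((hPderiv n (by omega) 1 hmem).sub (hasDerivAt_mulLogDeriv n one_pos))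
    simpa [mulLogDeriv] using h
  have hupper : ∀ᶠ t in 𝓝 (1 : ℝ), 0 ≤ (t - 1) * (f (t ^ 2 - 1) - P t) := by
    have htop' : 0 < -8 - iteratedDeriv 5 P 1 := by
      rw [hPone 5 (by omega)]
      norm_num [mulLogDeriv, Nat.factorial]
    have h := eventually_changes_sign_of_odd_order htop' (m := 4) (by decide)
      (h := fun j t => arctanBoundDeriv j t - iteratedDeriv j P t)
      (fun j hj => hnhds.mono fun t ht => (hasDerivAt_arctanBoundDeriv hj t).sub
        (hPderiv j (by omega) t ht))
      (fun j hj => sub_eq_zero.2 ((arctanBoundDeriv_one hj).trans (hPone j (by omega)).symm))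
      (hasDerivAt_arctanBoundDeriv_four_one.sub (hPderiv 4 (by omega) 1 hmem))
    filter_upwards [h, hnhds] with t ht hta
    rw [f_sq_sub_one (by linarith [hta.1])]
    simpa using ht
  have hf1 : f (1 ^ 2 - 1) = 0 := by
    rw [f_sq_sub_one zero_le_one, arctanBoundDeriv_one (by omega)]
    simp [mulLogDeriv]
  obtain ⟨ε, hε, hball⟩ := Metric.eventually_nhds_iff_ball.1 (hlower.and hupper)
  rw [Real.ball_eq_Ioo] at hball
  have hηε : min (ε / 2) a < ε := (min_le_left _ _).trans_lt (half_lt_self hε)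
  refine ⟨min (ε / 2) a, ⟨by positivity, min_le_right _ _⟩, fun t ht => ?_, fun t ht => ?_⟩
  · rcases ht.1.eq_or_lt with rfl | h1
    · simp only [hf1]; simp [hP0]
    · obtain ⟨hl, hu⟩ := hball t ⟨by linarith, by linarith [ht.2]⟩
      have hpos : 0 < t - 1 := sub_pos.2 h1
      exact ⟨sub_nonneg.1 (nonneg_of_mul_nonneg_right hl hpos),
        sub_nonneg.1 (nonneg_of_mul_nonneg_right hu hpos)⟩
  · rcases ht.2.eq_or_lt with rfl | h1
    · simp only [hf1]; simp [hP0]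
    · obtain ⟨hl, hu⟩ := hball t ⟨by linarith [ht.1], by linarith⟩
      have hneg : t - 1 < 0 := sub_neg.2 h1
      exact ⟨sub_nonpos.1 (nonpos_of_mul_nonneg_right hl hneg),
        sub_nonpos.1 (nonpos_of_mul_nonneg_right hu hneg)⟩
end

section
/- For every natural number n ≥ 1 and every real number x, the n-th derivative of the arctangent function satisfies (arctan)^(n)(x) = ((−1)^(n−1)·(n−1)!/(1+x²)^(n/2)) · sin(nπ/2 − n·arctan x). -/
open Real

/-- The iterated derivatives of `arctan` in terms of powers of `cos (arctan x)`. -/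
theorem iteratedDeriv_succ_arctan_eq_cos_pow_mul_sin (n : ℕ) :
    iteratedDeriv (n + 1) Real.arctan = fun x : ℝ =>
      (-1 : ℝ) ^ n * (Nat.factorial n : ℝ) * (cos (arctan x) ^ (n + 1) *
        sin ((n + 1 : ℕ) * (π / 2 - arctan x))) := by
  induction n with
  | zero =>
    funext x
    simp [iteratedDeriv_one, Real.deriv_arctan, sin_pi_div_two_sub, ← sq, cos_sq_arctan]
  | succ n ih =>
    rw [iteratedDeriv_succ, ih]
    funext x
    have hpow := ((hasDerivAt_arctan x).cos).pow (n + 1)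
    have hsin := (((hasDerivAt_arctan x).const_sub (π / 2)).const_mul ((n + 1 : ℕ) : ℝ)).sin
    refine ((hpow.mul hsin).const_mul ((-1 : ℝ) ^ n * (Nat.factorial n : ℝ))).deriv.trans ?_
    have hadd : sin (((n + 1 + 1 : ℕ) : ℝ) * (π / 2 - arctan x)) =
        sin ((n + 1 : ℕ) * (π / 2 - arctan x)) * sin (arctan x) +
          cos ((n + 1 : ℕ) * (π / 2 - arctan x)) * cos (arctan x) := by
      rw [Nat.cast_succ (n + 1), add_one_mul, sin_add, cos_pi_div_two_sub, sin_pi_div_two_sub]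
    rw [hadd, ← cos_sq_arctan, Nat.factorial_succ]
    simp only [Pi.pow_apply, Nat.add_sub_cancel]
    push_cast
    ring

/-- Powers of `cos (arctan x)` as real powers of `1 + x ^ 2`. -/
theorem cos_arctan_pow (n : ℕ) (x : ℝ) :
    cos (arctan x) ^ n = ((1 + x ^ 2) ^ ((n : ℝ) / 2))⁻¹ := by
  rw [cos_arctan, one_div, inv_pow, rpow_div_two_eq_sqrt _ (by positivity), rpow_natCast]

theorem iteratedDeriv_arctan (n : ℕ) (hn : 1 ≤ n) (x : ℝ) :
    iteratedDeriv n Real.arctan x =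
      (-1 : ℝ) ^ (n - 1) * (Nat.factorial (n - 1) : ℝ) / (1 + x ^ 2) ^ ((n : ℝ) / 2) *
        Real.sin (n * π / 2 - n * Real.arctan x) := by
  obtain ⟨m, rfl⟩ := Nat.exists_eq_add_of_le' hn
  simp only [iteratedDeriv_succ_arctan_eq_cos_pow_mul_sin, Nat.add_sub_cancel]
  rw [cos_arctan_pow, mul_sub,
    mul_div_assoc ((m + 1 : ℕ) : ℝ), div_eq_mul_inv _ ((1 + x ^ 2) ^ _), mul_assoc _ (_⁻¹)]
end

section
/- For every real number t ≥ 1, one has 2t·ln t ≤ f(t²−1), where f(x) := π + (1/2)(4+π)x − 2(x+2)·arctan(√(x+1)). -/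
open Real Set

/-- A function with nonnegative derivative on `[a, ∞)` that vanishes at `a` is nonnegative there. -/
lemma nonneg_of_hasDerivAt_nonneg {g g' : ℝ → ℝ} {a : ℝ} (ha : g a = 0)
    (hg : ∀ x, a ≤ x → HasDerivAt g (g' x) x) (hg' : ∀ x, a ≤ x → 0 ≤ g' x)
    {t : ℝ} (ht : a ≤ t) : 0 ≤ g t := by
  have hmono : MonotoneOn g (Ici a) := by
    refine monotoneOn_of_hasDerivWithinAt_nonneg (f' := g') (convex_Ici a)
      (fun x hx => (hg x hx).continuousAt.continuousWithinAt) (fun x hx => ?_) (fun x hx => ?_)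
    · exact (hg x (interior_subset hx)).hasDerivWithinAt
    · exact hg' x (interior_subset hx)
  simpa [ha] using hmono self_mem_Ici ht ht

lemma second_derivative_nonneg {t : ℝ} (ht : 1 ≤ t) :
    0 ≤ 4 + π - 4 * arctan t - 4 * t / (1 + t ^ 2) - 2 / t := by
  refine nonneg_of_hasDerivAt_nonneg
    (g := fun t => 4 + π - 4 * arctan t - 4 * t / (1 + t ^ 2) - 2 / t)
    (g' := fun t => 2 * (t ^ 2 - 1) ^ 2 / (t ^ 2 * (1 + t ^ 2) ^ 2))
    (by norm_num [arctan_one]; ring) (fun x hx => ?_) (fun x _ => by positivity) ht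
  have hx0 : x ≠ 0 := by linarith
  have hx1 : 1 + x ^ 2 ≠ 0 := by positivity
  have h := ((((hasDerivAt_arctan x).const_mul 4).const_sub (4 + π)).sub
    (((hasDerivAt_id x).const_mul 4).div (((hasDerivAt_id x).pow 2).const_add 1) hx1)).sub
    ((hasDerivAt_const x (2 : ℝ)).div (hasDerivAt_id x) hx0)
  refine h.congr_deriv ?_
  simp only [id, Pi.pow_apply]
  field_simp
  ring

lemma first_derivative_nonneg {t : ℝ} (ht : 1 ≤ t) :
    0 ≤ (4 + π) * t - 4 * (t * arctan t) - 2 * log t - 4 := by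
  refine nonneg_of_hasDerivAt_nonneg
    (g := fun t => (4 + π) * t - 4 * (t * arctan t) - 2 * log t - 4)
    (by norm_num [arctan_one]; ring) (fun x hx => ?_)
    (fun x hx => second_derivative_nonneg hx) ht
  have hx0 : x ≠ 0 := by linarith
  have h := ((((hasDerivAt_id x).const_mul (4 + π)).sub
    (((hasDerivAt_id x).mul (hasDerivAt_arctan x)).const_mul 4)).sub
    ((hasDerivAt_log hx0).const_mul 2)).sub_const 4
  refine h.congr_deriv ?_
  simp only [id]
  field_simp
  ring

theorem mul_log_le (t : ℝ) (ht : 1 ≤ t) : 2 * t * Real.log t ≤ f (t ^ 2 - 1) := by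
  have hsqrt : √(t ^ 2 - 1 + 1) = t := by
    rw [sub_add_cancel, sqrt_sq (by linarith)]
  have key : 0 ≤ π + 1 / 2 * (4 + π) * (t ^ 2 - 1) - 2 * ((t ^ 2 + 1) * arctan t)
      - 2 * (t * log t) := by
    refine nonneg_of_hasDerivAt_nonneg
      (g := fun t => π + 1 / 2 * (4 + π) * (t ^ 2 - 1) - 2 * ((t ^ 2 + 1) * arctan t)
        - 2 * (t * log t))
      (by norm_num [arctan_one]; ring) (fun x hx => ?_)
      (fun x hx => first_derivative_nonneg hx) ht
    have hx0 : x ≠ 0 := by linarith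
    have hpow := (hasDerivAt_id x).pow 2
    have h := ((((hpow.sub_const 1).const_mul (1 / 2 * (4 + π))).const_add π).sub
      (((hpow.add_const 1).mul (hasDerivAt_arctan x)).const_mul 2)).sub
      (((hasDerivAt_id x).mul (hasDerivAt_log hx0)).const_mul 2)
    refine h.congr_deriv ?_
    simp only [id, Pi.pow_apply]
    field_simp
    ring
  rw [f, hsqrt]
  linarith
end

section
/- For every real number t > 0, one has ln t ≤ (1/2)(4+π)·t − 2t·arctan t − 2. -/
open Real

/-- The difference of the two sides of the inequality `log_le_arctan_bound`. -/
noncomputable def logArctanGap (x : ℝ) : ℝ :=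
  (1 / 2) * (4 + π) * x - 2 * x * Real.arctan x - 2 - Real.log x

/-- The derivative of `logArctanGap` on the positive reals. -/
noncomputable def logArctanGapDeriv (x : ℝ) : ℝ :=
  (1 / 2) * (4 + π) - 2 * Real.arctan x - 2 * x / (1 + x ^ 2) - x⁻¹

lemma hasDerivAt_logArctanGap {x : ℝ} (hx : x ≠ 0) :
    HasDerivAt logArctanGap (logArctanGapDeriv x) x := by
  have h := (((hasDerivAt_id x).const_mul ((1 / 2) * (4 + π))).sub
    (((hasDerivAt_id x).const_mul 2).mul (Real.hasDerivAt_arctan x))).sub_const 2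
    |>.sub (Real.hasDerivAt_log hx)
  refine h.congr_deriv ?_
  simp only [logArctanGapDeriv, id]
  ring

lemma hasDerivAt_logArctanGapDeriv {x : ℝ} (hx : x ≠ 0) :
    HasDerivAt logArctanGapDeriv (((x ^ 2 - 1) / (x * (1 + x ^ 2))) ^ 2) x := by
  have hne : 1 + x ^ 2 ≠ 0 := by positivity
  have h := ((((Real.hasDerivAt_arctan x).const_mul 2).const_sub ((1 / 2) * (4 + π))).sub
    (((hasDerivAt_id x).const_mul 2).div (((hasDerivAt_id x).pow 2).const_add 1) hne)).sub
    (hasDerivAt_inv hx)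
  refine h.congr_deriv ?_
  simp only [id, Pi.pow_apply]
  field_simp
  ring

lemma convexOn_logArctanGap : ConvexOn ℝ (Set.Ioi 0) logArctanGap := by
  have hne {x : ℝ} (hx : x ∈ interior (Set.Ioi (0 : ℝ))) : x ≠ 0 :=
    ne_of_gt (interior_subset hx)
  exact convexOn_of_hasDerivWithinAt2_nonneg (convex_Ioi 0)
    (fun x hx => (hasDerivAt_logArctanGap (ne_of_gt hx)).continuousAt.continuousWithinAt)
    (fun x hx => (hasDerivAt_logArctanGap (hne hx)).hasDerivWithinAt)
    (fun x hx => (hasDerivAt_logArctanGapDeriv (hne hx)).hasDerivWithinAt)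
    (fun x _ => sq_nonneg _)

lemma isMinOn_logArctanGap : IsMinOn logArctanGap (Set.Ioi 0) 1 := by
  refine convexOn_logArctanGap.isMinOn_of_rightDeriv_eq_zero (by simp) ?_
  rw [(hasDerivAt_logArctanGap one_ne_zero).hasDerivWithinAt.derivWithin
    (uniqueDiffWithinAt_Ioi 1), logArctanGapDeriv, Real.arctan_one]
  ring

theorem log_le_arctan_bound (t : ℝ) (ht : 0 < t) :
    Real.log t ≤ (1 / 2) * (4 + π) * t - 2 * t * Real.arctan t - 2 := by
  have h : logArctanGap 1 ≤ logArctanGap t := isMinOn_logArctanGap ht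
  simp only [logArctanGap, Real.arctan_one, Real.log_one] at h
  linarith
end

section
/- For every real number x ≥ 0, one has ln(1+x) ≤ f(x)/√(x+1), where f(x) := π + (1/2)(4+π)x − 2(x+2)·arctan(√(x+1)). -/
open Real Set

theorem nonneg_of_hasDerivAt_nonneg_of_one_le {g g' : ℝ → ℝ} (h1 : g 1 = 0)
    (hd : ∀ t, 1 ≤ t → HasDerivAt g (g' t) t) (hg' : ∀ t, 1 ≤ t → 0 ≤ g' t)
    {t : ℝ} (ht : 1 ≤ t) : 0 ≤ g t := by
  have hmono : MonotoneOn g (Ici 1) :=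
    monotoneOn_of_hasDerivWithinAt_nonneg (f' := g') (convex_Ici 1)
      (fun s hs => (hd s hs).continuousAt.continuousWithinAt)
      (fun s hs => (hd s (interior_subset hs)).hasDerivWithinAt)
      (fun s hs => hg' s (interior_subset hs))
  simpa [h1] using hmono self_mem_Ici ht ht

theorem pi_div_two_sub_two_mul_arctan_add_nonneg {t : ℝ} (ht : 1 ≤ t) :
    0 ≤ π / 2 - 2 * arctan t + 2 * ((t - 1) / (t + 1)) := by
  refine nonneg_of_hasDerivAt_nonneg_of_one_le
    (g := fun t => π / 2 - 2 * arctan t + 2 * ((t - 1) / (t + 1)))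
    (g' := fun t => 2 * (t - 1) ^ 2 / ((1 + t ^ 2) * (t + 1) ^ 2)) ?_ ?_ ?_ ht
  · simp only [arctan_one]
    ring
  · intro s hs
    have hs' : s + 1 ≠ 0 := by positivity
    have h := (((hasDerivAt_arctan s).const_mul 2).const_sub (π / 2)).add
      ((((hasDerivAt_id' s).sub_const 1).div ((hasDerivAt_id' s).add_const 1) hs').const_mul 2)
    refine h.congr_deriv ?_
    field_simp
    ring
  · intro s _
    positivity

theorem add_inv_mul_arctan_sub_log_nonneg {t : ℝ} (ht : 1 ≤ t) :
    0 ≤ (t + t⁻¹) * (π / 2 - 2 * arctan t) + 2 * (t - t⁻¹) - 2 * log t := by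
  refine nonneg_of_hasDerivAt_nonneg_of_one_le
    (g := fun t => (t + t⁻¹) * (π / 2 - 2 * arctan t) + 2 * (t - t⁻¹) - 2 * log t)
    (g' := fun t => (t ^ 2 - 1) / t ^ 2 *
      (π / 2 - 2 * arctan t + 2 * ((t - 1) / (t + 1)))) ?_ ?_ ?_ ht
  · simp only [arctan_one, log_one]
    ring
  · intro s hs
    have hs0 : s ≠ 0 := by positivity
    have hs' : s + 1 ≠ 0 := by positivity
    have h := ((((hasDerivAt_id' s).add (hasDerivAt_inv hs0)).mul
      (((hasDerivAt_arctan s).const_mul 2).const_sub (π / 2))).add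
      (((hasDerivAt_id' s).sub (hasDerivAt_inv hs0)).const_mul 2)).sub
      ((hasDerivAt_log hs0).const_mul 2)
    refine h.congr_deriv ?_
    simp only [Pi.add_apply]
    field_simp
    ring
  · intro s hs
    have hs2 : 0 ≤ s ^ 2 - 1 := by nlinarith
    exact mul_nonneg (by positivity) (pi_div_two_sub_two_mul_arctan_add_nonneg hs)

theorem log_le_f_div_sqrt (x : ℝ) (hx : 0 ≤ x) :
    Real.log (1 + x) ≤ f x / Real.sqrt (x + 1) := by
  obtain ⟨t, ht, rfl⟩ : ∃ t : ℝ, 1 ≤ t ∧ x = t ^ 2 - 1 :=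
    ⟨√(x + 1), one_le_sqrt.2 (by linarith), by rw [sq_sqrt (by linarith)]; ring⟩
  have ht0 : 0 < t := by linarith
  have hf : f (t ^ 2 - 1) / √(t ^ 2 - 1 + 1) =
      (t + t⁻¹) * (π / 2 - 2 * arctan t) + 2 * (t - t⁻¹) := by
    rw [f, sub_add_cancel, sqrt_sq ht0.le]
    field_simp
    ring
  rw [hf, add_sub_cancel, log_pow]
  push_cast
  linarith [add_inv_mul_arctan_sub_log_nonneg ht]
end

section
/- For every real number x ∈ (−1, 0], one has ln(1+x) ≥ f(x)/√(x+1), where f(x) := π + (1/2)(4+π)x − 2(x+2)·arctan(√(x+1)). -/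
open Real Set

lemma one_add_mul_log_le {t : ℝ} (h0 : 0 < t) (h1 : t ≤ 1) :
    (1 + t) * Real.log t ≤ 2 * (t - 1) := by
  have h := Real.le_log_one_add_of_nonneg (x := (1 - t) / t) (div_nonneg (by linarith) h0.le)
  have e1 : 1 + (1 - t) / t = t⁻¹ := by field_simp; ring
  have e2 : 2 * ((1 - t) / t) / ((1 - t) / t + 2) = 2 * (1 - t) / (1 + t) := by
    have : (1 - t) / t + 2 = (1 + t) / t := by field_simp; ring
    rw [this]
    field_simp
  rw [e1, e2, Real.log_inv, div_le_iff₀ (by linarith)] at h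
  linarith

lemma hasDerivAt_log_add_arctan {t : ℝ} (h0 : 0 < t) :
    HasDerivAt
      (fun t : ℝ ↦ 2 * (t * Real.log t) / (1 + t ^ 2) + 2 * Real.arctan t
        - 2 * (t ^ 2 - 1) / (1 + t ^ 2))
      (2 * (1 - t) / (1 + t ^ 2) ^ 2 * ((1 + t) * Real.log t - 2 * (t - 1))) t := by
  have hne : 1 + t ^ 2 ≠ 0 := by positivity
  have hsq : HasDerivAt (fun t : ℝ ↦ t ^ 2) (2 * t) t := by
    simpa using hasDerivAt_pow 2 t
  have hden := hsq.const_add 1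
  refine HasDerivAt.congr_deriv (((((Real.hasDerivAt_mul_log h0.ne').const_mul 2).div hden hne).add
    ((Real.hasDerivAt_arctan t).const_mul 2)).sub
    (((hsq.sub_const 1).const_mul 2).div hden hne)) ?_
  field_simp
  ring

lemma pi_div_two_le_log_add_arctan {t : ℝ} (h0 : 0 < t) (h1 : t ≤ 1) :
    π / 2 ≤ 2 * (t * Real.log t) / (1 + t ^ 2) + 2 * Real.arctan t
      - 2 * (t ^ 2 - 1) / (1 + t ^ 2) := by
  have hanti := antitoneOn_of_hasDerivWithinAt_nonpos (convex_Icc t 1)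
    (fun s hs ↦ (hasDerivAt_log_add_arctan (h0.trans_le hs.1)).continuousAt.continuousWithinAt)
    (fun s hs ↦ (hasDerivAt_log_add_arctan
      (h0.trans_le (interior_subset hs).1)).hasDerivWithinAt)
    (fun s hs ↦ by
      obtain ⟨hs0, hs1⟩ := interior_subset hs
      have := one_add_mul_log_le (h0.trans_le hs0) hs1
      exact mul_nonpos_of_nonneg_of_nonpos
        (div_nonneg (by linarith) (by positivity)) (by linarith))
  have h := hanti (left_mem_Icc.2 h1) (right_mem_Icc.2 h1) h1
  norm_num [Real.arctan_one] at h
  linarith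

theorem log_ge_f_div_sqrt (x : ℝ) (hx : x ∈ Set.Ioc (-1 : ℝ) 0) :
    Real.log (1 + x) ≥ f x / Real.sqrt (x + 1) := by
  obtain ⟨hx0, hx1⟩ := hx
  have ht0 : 0 < √(x + 1) := Real.sqrt_pos.2 (by linarith)
  have ht1 : √(x + 1) ≤ 1 := Real.sqrt_le_one.2 (by linarith)
  have hsq : √(x + 1) ^ 2 = x + 1 := Real.sq_sqrt (by linarith)
  unfold f
  generalize √(x + 1) = t at *
  obtain rfl : x = t ^ 2 - 1 := by linarith
  have hlog : Real.log (1 + (t ^ 2 - 1)) = 2 * Real.log t := by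
    rw [add_sub_cancel, Real.log_pow, Nat.cast_ofNat]
  rw [hlog, ge_iff_le, div_le_iff₀ ht0]
  have h := mul_le_mul_of_nonneg_right (pi_div_two_le_log_add_arctan ht0 ht1)
    (by positivity : 0 ≤ 1 + t ^ 2)
  have e : (2 * (t * Real.log t) / (1 + t ^ 2) + 2 * Real.arctan t
      - 2 * (t ^ 2 - 1) / (1 + t ^ 2)) * (1 + t ^ 2) =
      2 * (t * Real.log t) + 2 * Real.arctan t * (1 + t ^ 2) - 2 * (t ^ 2 - 1) := by
    field_simp
  rw [e] at h
  linarith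
end

section
/- For every real number x ≥ 0, one has ln(1+x) ≤ x(6+x)/(2(3+2x)). -/
theorem hasDerivAt_rational_sub_log {x : ℝ} (hx : 0 ≤ x) :
    HasDerivAt (fun y : ℝ => y * (6 + y) / (2 * (3 + 2 * y)) - Real.log (1 + y))
      (x ^ 3 / ((3 + 2 * x) ^ 2 * (1 + x))) x := by
  have h1 : 1 + x ≠ 0 := by positivity
  have h2 : 3 + 2 * x ≠ 0 := by positivity
  have hnum : HasDerivAt (fun y : ℝ => y * (6 + y)) (1 * (6 + x) + x * 1) x :=
    (hasDerivAt_id' x).mul ((hasDerivAt_id' x).const_add 6)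
  have hden : HasDerivAt (fun y : ℝ => 2 * (3 + 2 * y)) (2 * (2 * 1)) x :=
    (((hasDerivAt_id' x).const_mul 2).const_add 3).const_mul 2
  have hlog : HasDerivAt (fun y : ℝ => Real.log (1 + y)) (1 / (1 + x)) x :=
    ((hasDerivAt_id' x).const_add 1).log h1
  refine ((hnum.div hden (mul_ne_zero two_ne_zero h2)).sub hlog).congr_deriv ?_
  field_simp
  ring

theorem log_le_rational_two (x : ℝ) (hx : 0 ≤ x) :
    Real.log (1 + x) ≤ x * (6 + x) / (2 * (3 + 2 * x)) := by
  have hmono : MonotoneOn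
      (fun y : ℝ => y * (6 + y) / (2 * (3 + 2 * y)) - Real.log (1 + y)) (Set.Ici 0) := by
    refine monotoneOn_of_hasDerivWithinAt_nonneg (convex_Ici 0)
      (fun y hy => (hasDerivAt_rational_sub_log hy).continuousAt.continuousWithinAt)
      (fun y hy => (hasDerivAt_rational_sub_log (interior_subset hy)).hasDerivWithinAt)
      (fun y hy => ?_)
    have hy0 : 0 ≤ y := interior_subset hy
    positivity
  have h := hmono Set.self_mem_Ici hx hx
  simpa using h
end
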